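/- arXiv:2504.04125 — 2 statements merged into one kernel-verified Lean document; each statement's English description precedes it below -/
import Mathlib

section
/- Let n, m be positive integers and r, s natural numbers. There exists a complex (2n)×m matrix x with rank(x) = r and rank(xᵀ·J·x) = s if and only if s is even, s ≤ r, r ≤ m, and 2r − s ≤ 2n. Equivalently, there exists an r-dimensional linear subspace W₁ of ℂ^{2n} on which the restriction of the symplectic form Ω has rank s if and only if s is even, s ≤ r, and 2r − s ≤ 2n. -/
open Matrix

/-- The standard symplectic matrix `J = [[0, 1ₙ], [-1ₙ, 0]]`. -/
def symJ (n : ℕ) : Matrix (Fin n ⊕ Fin n) (Fin n ⊕ Fin n) ℂ :=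
  Matrix.fromBlocks 0 1 (-1) 0

namespace Matrix

variable {K l m n p : Type*} [Field K] [Fintype l] [Fintype m] [Fintype n] [Fintype p]

/-- Multiplying by a left-invertible matrix on the left and by a right-invertible matrix on the
right does not change the rank. -/
theorem rank_mul_mul_of_leftInverse_of_rightInverse [DecidableEq m] [DecidableEq n]
    {C : Matrix l m K} {C' : Matrix m l K} {R : Matrix n p K} {R' : Matrix p n K}
    (hC : C' * C = 1) (hR : R * R' = 1) (M : Matrix m n K) : (C * M * R).rank = M.rank := by
  refine le_antisymm ((rank_mul_le_left _ _).trans (rank_mul_le_right _ _)) ?_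
  have h : C' * (C * M * R) * R' = M := by
    simp only [Matrix.mul_assoc, hR, Matrix.mul_one]
    rw [← Matrix.mul_assoc, hC, Matrix.one_mul]
  calc M.rank = (C' * (C * M * R) * R').rank := by rw [h]
    _ ≤ (C * M * R).rank := (rank_mul_le_left _ _).trans (rank_mul_le_right _ _)

/-- Sylvester's rank inequality. -/
theorem rank_add_rank_le_rank_mul_add_card {ι : Type*} (A : Matrix ι m K) (B : Matrix m n K) :
    A.rank + B.rank ≤ (A * B).rank + Fintype.card m := by
  have hA := A.mulVecLin.finrank_range_add_finrank_ker
  have hB := (A.mulVecLin.domRestrict B.mulVecLin.range).finrank_range_add_finrank_ker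
  have hker : Module.finrank K (A.mulVecLin.domRestrict B.mulVecLin.range).ker ≤
      Module.finrank K A.mulVecLin.ker := by
    refine LinearMap.finrank_le_finrank_of_injective
      (f := (B.mulVecLin.range.subtype.restrict fun x hx => hx :
        (A.mulVecLin.domRestrict B.mulVecLin.range).ker →ₗ[K] A.mulVecLin.ker)) ?_
    intro x y hxy
    exact Subtype.ext (Subtype.ext (congrArg (fun z : A.mulVecLin.ker => (z : m → K)) hxy))
  have hAB : (A * B).rank =
      Module.finrank K (A.mulVecLin.domRestrict B.mulVecLin.range).range := by
    rw [rank, mulVecLin_mul, LinearMap.range_comp, LinearMap.range_domRestrict]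
  rw [Module.finrank_fintype_fun_eq_card] at hA
  rw [hAB, rank, rank]
  omega

/-- The column space of a matrix is the image of a left-invertible matrix with as many columns as
the rank. -/
theorem exists_leftInverse_mul_mul_eq_self (A : Matrix m n K) :
    ∃ (C : Matrix m (Fin A.rank) K) (L : Matrix (Fin A.rank) m K), L * C = 1 ∧ C * L * A = A := by
  classical
  let b : Module.Basis (Fin A.rank) K A.mulVecLin.range := Module.finBasis K A.mulVecLin.range
  let c : (Fin A.rank → K) →ₗ[K] (m → K) :=
    A.mulVecLin.range.subtype ∘ₗ b.equivFun.symm.toLinearMap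
  have hc : c.ker = ⊥ := LinearMap.ker_eq_bot.mpr
    (Subtype.val_injective.comp b.equivFun.symm.injective)
  obtain ⟨g, hg⟩ := c.exists_leftInverse_of_injective hc
  refine ⟨c.toMatrix', g.toMatrix', ?_, ?_⟩
  · rw [← LinearMap.toMatrix'_comp, hg, LinearMap.toMatrix'_id]
  · apply Matrix.toLin'.injective
    rw [Matrix.toLin'_mul, Matrix.toLin'_mul, toLin'_toMatrix', toLin'_toMatrix']
    refine LinearMap.ext fun v => ?_
    obtain ⟨w, hw⟩ : ∃ w, c w = toLin' A v :=
      ⟨b.equivFun ⟨A.mulVecLin v, v, rfl⟩, by simp [c]⟩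
    have hgw : g (c w) = w := LinearMap.congr_fun hg w
    simp only [LinearMap.comp_apply]
    rw [← hw, hgw]

/-- An invertible skew-symmetric matrix over a field of characteristic zero has even size. -/
theorem even_card_of_transpose_eq_neg [CharZero K] [DecidableEq n] {M : Matrix n n K}
    (hM : Mᵀ = -M) (hdet : M.det ≠ 0) : Even (Fintype.card n) := by
  by_contra hodd
  have h : M.det = -M.det := by
    conv_lhs => rw [← det_transpose, hM, det_neg, (Nat.not_even_iff_odd.mp hodd).neg_one_pow,
      neg_one_mul]
  exact hdet (self_eq_neg.mp h)

/-- The rank of a skew-symmetric matrix over a field of characteristic zero is even. -/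
theorem even_rank_of_transpose_eq_neg [CharZero K] {A : Matrix n n K} (hA : Aᵀ = -A) :
    Even A.rank := by
  obtain ⟨C, L, -, h⟩ := A.exists_leftInverse_mul_mul_eq_self
  have h' : A * (Lᵀ * Cᵀ) = A := by
    have := congrArg transpose h
    rwa [transpose_mul, transpose_mul, hA, Matrix.neg_mul, neg_inj] at this
  have hrank : A.rank ≤ (L * A * Lᵀ).rank := by
    have hfac : C * (L * A * Lᵀ) * Cᵀ = A := by
      rw [show C * (L * A * Lᵀ) * Cᵀ = C * L * (A * (Lᵀ * Cᵀ)) by simp only [Matrix.mul_assoc],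
        h', h]
    calc A.rank = (C * (L * A * Lᵀ) * Cᵀ).rank := by rw [hfac]
      _ ≤ (L * A * Lᵀ).rank := (rank_mul_le_left _ _).trans (rank_mul_le_right _ _)
  have hunit : IsUnit (L * A * Lᵀ) := by
    rw [← mulVec_injective_iff_isUnit]
    change Function.Injective (L * A * Lᵀ).mulVecLin
    rw [LinearMap.injective_iff_surjective, ← LinearMap.range_eq_top]
    apply Submodule.eq_top_of_finrank_eq
    rw [Module.finrank_fin_fun]
    exact le_antisymm (rank_le_width _) hrank
  have hskew : (L * A * Lᵀ)ᵀ = -(L * A * Lᵀ) := by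
    simp [transpose_mul, hA, Matrix.mul_assoc]
  simpa using even_card_of_transpose_eq_neg hskew
    ((isUnit_iff_isUnit_det _).mp hunit).ne_zero

theorem one_submatrix_transpose_mul_self {ι : Type*} [DecidableEq ι] [DecidableEq l]
    {f : ι → l} (hf : Function.Injective f) :
    ((1 : Matrix l l K).submatrix id f)ᵀ * (1 : Matrix l l K).submatrix id f = 1 := by
  rw [transpose_submatrix, transpose_one, ← submatrix_mul _ _ f id f Function.bijective_id,
    Matrix.one_mul, submatrix_one f hf]

end Matrix

theorem symJ_transpose (n : ℕ) : (symJ n)ᵀ = -symJ n := by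
  simp [symJ, fromBlocks_transpose, fromBlocks_neg]

theorem isUnit_det_symJ (n : ℕ) : IsUnit (symJ n).det := by
  have h : symJ n = -Matrix.J (Fin n) ℂ := by simp [symJ, Matrix.J, fromBlocks_neg]
  rw [h, det_neg]
  exact (isUnit_one.neg.pow _).mul (isUnit_det_J _ _)

/-- A `(2n)×m` matrix of rank `a + k` on whose column space the symplectic form has rank `2k`: its
nonzero columns are the first `a` vectors of one half of a symplectic basis and the first `k`
vectors of the other half. -/
theorem exists_rank_eq_and_rank_symJ_eq {n m a k : ℕ} (hka : k ≤ a) (han : a ≤ n)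
    (ham : a + k ≤ m) : ∃ x : Matrix (Fin n ⊕ Fin n) (Fin m) ℂ,
      x.rank = a + k ∧ (xᵀ * symJ n * x).rank = 2 * k := by
  let E : Matrix (Fin n) (Fin a) ℂ := (1 : Matrix _ _ ℂ).submatrix id (Fin.castLE han)
  let D : Matrix (Fin a) (Fin k) ℂ := (1 : Matrix _ _ ℂ).submatrix id (Fin.castLE hka)
  let P : Matrix (Fin m) (Fin a ⊕ Fin k) ℂ :=
    (1 : Matrix _ _ ℂ).submatrix id (Fin.castLE ham ∘ finSumFinEquiv)
  have hE : Eᵀ * E = 1 := one_submatrix_transpose_mul_self (Fin.castLE_injective han)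
  have hD : Dᵀ * D = 1 := one_submatrix_transpose_mul_self (Fin.castLE_injective hka)
  have hP : Pᵀ * P = 1 := one_submatrix_transpose_mul_self
    ((Fin.castLE_injective ham).comp finSumFinEquiv.injective)
  let U : Matrix (Fin n ⊕ Fin n) (Fin a ⊕ Fin k) ℂ := fromBlocks E 0 0 (E * D)
  let S : Matrix (Fin a ⊕ Fin k) (Fin k ⊕ Fin k) ℂ := fromBlocks D 0 0 1
  have hED : Dᵀ * Eᵀ * (E * D) = 1 := by
    rw [Matrix.mul_assoc, ← Matrix.mul_assoc Eᵀ, hE, Matrix.one_mul, hD]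
  have hU : Uᵀ * U = 1 := by
    simp [U, fromBlocks_transpose, fromBlocks_multiply, hE, hED]
  have hS : Sᵀ * S = 1 := by
    simp [S, fromBlocks_transpose, fromBlocks_multiply, hD]
  have hUS : Uᵀ * symJ n * U = S * symJ k * Sᵀ := by
    simp [U, S, symJ, fromBlocks_transpose, fromBlocks_multiply, ← Matrix.mul_assoc, hE]
    simp only [Matrix.mul_assoc, hE, Matrix.mul_one]
  refine ⟨U * Pᵀ, ?_, ?_⟩
  · have h := rank_mul_mul_of_leftInverse_of_rightInverse hU hP 1
    rw [Matrix.mul_one, rank_one] at h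
    simpa using h
  · have hfac : (U * Pᵀ)ᵀ * symJ n * (U * Pᵀ) = P * S * symJ k * (P * S)ᵀ := by
      calc (U * Pᵀ)ᵀ * symJ n * (U * Pᵀ) = P * (Uᵀ * symJ n * U) * Pᵀ := by
            simp only [transpose_mul, transpose_transpose, Matrix.mul_assoc]
        _ = P * S * symJ k * (P * S)ᵀ := by
            rw [hUS]
            simp only [transpose_mul, Matrix.mul_assoc]
    have hPS : (P * S)ᵀ * (P * S) = 1 := by
      rw [transpose_mul, Matrix.mul_assoc, ← Matrix.mul_assoc Pᵀ, hP, Matrix.one_mul, hS]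
    rw [hfac, rank_mul_mul_of_leftInverse_of_rightInverse hPS hPS,
      rank_of_isUnit _ ((isUnit_iff_isUnit_det _).mpr (isUnit_det_symJ k))]
    simp [two_mul]

/-- There is a `(2n)×m` complex matrix of rank `r` whose column space meets the
symplectic form in rank `s` iff `s` is even, `s ≤ r ≤ m` and `2r - s ≤ 2n`. -/
theorem orbit_nonempty_iff (n m : ℕ) (hn : 0 < n) (hm : 0 < m) (r s : ℕ) :
    (∃ x : Matrix (Fin n ⊕ Fin n) (Fin m) ℂ,
        x.rank = r ∧ (xᵀ * symJ n * x).rank = s) ↔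
      (Even s ∧ s ≤ r ∧ r ≤ m ∧ 2 * r - s ≤ 2 * n) := by
  constructor
  · rintro ⟨x, rfl, rfl⟩
    refine ⟨even_rank_of_transpose_eq_neg ?_, rank_mul_le_right _ _, ?_, ?_⟩
    · simp [transpose_mul, symJ_transpose, Matrix.mul_assoc]
    · simpa using x.rank_le_card_width
    · have h := rank_add_rank_le_rank_mul_add_card (xᵀ * symJ n) x
      rw [rank_mul_eq_left_of_isUnit_det _ _ (isUnit_det_symJ n), rank_transpose,
        Fintype.card_sum, Fintype.card_fin] at h
      omega
  · rintro ⟨⟨k, rfl⟩, hsr, hrm, hrn⟩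
    obtain ⟨x, hx, hxs⟩ := exists_rank_eq_and_rank_symJ_eq (n := n) (m := m) (a := r - k) (k := k)
      (by omega) (by omega) (by omega)
    exact ⟨x, by omega, by omega⟩
end

section
/- Let p, q, i be positive integers with i ≤ min(p,q). Let x₀ be a complex q×p matrix of rank i and y₀ a nonzero row vector of length p lying in the row space of x₀. Suppose x' is a complex p×q matrix and y' ∈ ℂᵖ is a column vector such that x₀·x' = 0 and x'·x₀ + y'·y₀ = 0 (an identity of p×p matrices, where y'·y₀ is the outer product with entries (y')ⱼ·(y₀)ₖ). Then rank(x') ≤ min(p − i, q − i + 1). -/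
open Matrix

/-- The rank of matrices over a field is subadditive. -/
theorem Matrix.rank_add_le_rank_add_rank {K m n : Type*} [Field K] [Fintype m] [Fintype n]
    (A B : Matrix m n K) : (A + B).rank ≤ A.rank + B.rank := by
  unfold Matrix.rank
  rw [Matrix.mulVecLin_add]
  exact (Submodule.finrank_mono (LinearMap.range_add_le _ _)).trans
    (Submodule.finrank_add_le_finrank_add_finrank _ _)

/-- Rank bound for elements of the conormal space at `(x₀, y₀)` to the orbit
`Z_i ⊆ Hom(ℂᵖ, ℂ^q) ⊕ ℂ^{p*}`. -/
theorem conormal_rank_bound_hom (p q i : ℕ) (hp : 0 < p) (hq : 0 < q)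
    (hi : 0 < i) (hipq : i ≤ min p q)
    (x₀ : Matrix (Fin q) (Fin p) ℂ) (hrx₀ : x₀.rank = i)
    (y₀ : Fin p → ℂ) (hy₀ : y₀ ≠ 0) (hy₀x : y₀ ∈ LinearMap.range x₀ᵀ.mulVecLin)
    (x' : Matrix (Fin p) (Fin q) ℂ) (y' : Fin p → ℂ)
    (h1 : x₀ * x' = 0) (h2 : x' * x₀ + Matrix.vecMulVec y' y₀ = 0) :
    x'.rank ≤ min (p - i) (q - i + 1) := by
  obtain ⟨z, rfl⟩ := hy₀x
  have hp_bound := rank_add_rank_le_card_of_mul_eq_zero h1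
  have hmul : (x' + vecMulVec y' z) * x₀ = 0 := by
    rw [Matrix.add_mul, vecMulVec_mul, ← mulVec_transpose]
    exact h2
  have hq_bound := rank_add_rank_le_card_of_mul_eq_zero hmul
  have hadd := rank_add_le_rank_add_rank (x' + vecMulVec y' z) (vecMulVec (-y') z)
  rw [neg_vecMulVec, add_neg_cancel_right, ← neg_vecMulVec] at hadd
  have hone := rank_vecMulVec_le (-y') z
  rw [Fintype.card_fin] at hp_bound hq_bound
  omega
end
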